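/- Let G be a dense, K_4^3 ∪ e-free 3-graph with λ(G) > √3/18. Then G is K_5^{3−}-free, where K_5^{3−} is the 3-graph obtained from the complete 3-graph on 5 vertices by removing one edge. -/

import Mathlib

open Finset

/-- An `r`-uniform hypergraph (r-graph) with vertices drawn from `ℕ`. -/
structure HyperGraph (r : ℕ) where
  verts : Finset ℕ
  edges : Finset (Finset ℕ)
  edges_sub : ∀ e ∈ edges, e ⊆ verts
  card_eq : ∀ e ∈ edges, e.card = r

/-- A 3-uniform hypergraph (3-graph). -/
abbrev ThreeGraph := HyperGraph 3

/-- A feasible weight vector on `G`: nonnegative weights on the vertices summing to 1. -/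
def HyperGraph.IsFeasible {r : ℕ} (G : HyperGraph r) (w : ℕ → ℝ) : Prop :=
  (∀ v ∈ G.verts, 0 ≤ w v) ∧ ∑ v ∈ G.verts, w v = 1

/-- The Lagrangian function `λ(G, w) = Σ_{e ∈ E(G)} Π_{v ∈ e} w v`. -/
noncomputable def HyperGraph.lagFun {r : ℕ} (G : HyperGraph r) (w : ℕ → ℝ) : ℝ :=
  ∑ e ∈ G.edges, ∏ v ∈ e, w v

/-- The Lagrangian `λ(G)`: the maximum of `λ(G, w)` over feasible weight vectors. -/
noncomputable def HyperGraph.lag {r : ℕ} (G : HyperGraph r) : ℝ :=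
  sSup {x : ℝ | ∃ w, G.IsFeasible w ∧ G.lagFun w = x}

/-- `G` contains a copy of `F`: an injection of the vertices of `F` into those of `G`
mapping every edge of `F` to an edge of `G`. -/
def HyperGraph.ContainsCopy {r : ℕ} (G F : HyperGraph r) : Prop :=
  ∃ f : ℕ → ℕ, Set.InjOn f ↑F.verts ∧ (∀ v ∈ F.verts, f v ∈ G.verts) ∧
    ∀ e ∈ F.edges, e.image f ∈ G.edges

/-- `G` is `F`-free. -/
def HyperGraph.Free {r : ℕ} (G F : HyperGraph r) : Prop := ¬ G.ContainsCopy F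

/-- `H` is a subgraph of `G`. -/
def HyperGraph.IsSubgraph {r : ℕ} (H G : HyperGraph r) : Prop :=
  H.verts ⊆ G.verts ∧ H.edges ⊆ G.edges

/-- `G` is dense: every proper subgraph has strictly smaller Lagrangian. -/
def HyperGraph.LagDense {r : ℕ} (G : HyperGraph r) : Prop :=
  ∀ H : HyperGraph r, H.IsSubgraph G → (H.verts ≠ G.verts ∨ H.edges ≠ G.edges) →
    H.lag < G.lag

/-- The Lagrangian density `π_λ(F) = sup { r! · λ(G) : G is F-free }`. -/
noncomputable def lagDensity {r : ℕ} (F : HyperGraph r) : ℝ :=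
  sSup {x : ℝ | ∃ G : HyperGraph r, G.Free F ∧ x = (Nat.factorial r : ℝ) * G.lag}

/-- An optimum weight vector for `G`. -/
def HyperGraph.IsOptimal {r : ℕ} (G : HyperGraph r) (w : ℕ → ℝ) : Prop :=
  G.IsFeasible w ∧ G.lagFun w = G.lag

/-- `K_4^3 ∪ e`: the disjoint union of the complete 3-graph on `{1,2,3,4}`
and the single edge `{5,6,7}`. -/
def K43e : ThreeGraph where
  verts := {1, 2, 3, 4, 5, 6, 7}
  edges := {{1, 2, 3}, {1, 2, 4}, {1, 3, 4}, {2, 3, 4}, {5, 6, 7}}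
  edges_sub := by decide
  card_eq := by decide

/-- `K_5^{3−}`: the complete 3-graph on `{1, 2, 3, 4, 5}` with the edge `{3, 4, 5}`
removed. -/
def K53minus : ThreeGraph where
  verts := {1, 2, 3, 4, 5}
  edges := (Finset.powersetCard 3 ({1, 2, 3, 4, 5} : Finset ℕ)).erase {3, 4, 5}
  edges_sub := by decide
  card_eq := by decide


lemma poly_sqrt : (0.0962:ℝ) ≤ Real.sqrt 3 / 18 := by
  have : (1.7316:ℝ) ≤ Real.sqrt 3 := by
    apply Real.le_sqrt_of_sq_le; norm_num
  linarith

lemma poly_base (s : ℝ) (h0 : 0 ≤ s) (h1 : s ≤ 1) :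
    s*(1-s)*(2-s)/4 ≤ Real.sqrt 3 / 18 := by
  have h3 : Real.sqrt 3 ^ 2 = 3 := Real.sq_sqrt (by norm_num)
  set k := Real.sqrt 3 with hk
  have hkp : 0 ≤ k := Real.sqrt_nonneg 3
  have hk2 : k ≤ 2 := by nlinarith
  have : k/18 - s*(1-s)*(2-s)/4 = (s - (1 - k/3))^2 * (1 + 2*k/3 - s)/4 := by
    have h33 : k^3 = 3*k := by rw [pow_succ, h3]
    ring_nf
    rw [h33, h3]; ring
  have : 0 ≤ (s - (1 - k/3))^2 * (1 + 2*k/3 - s)/4 := by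
    apply div_nonneg _ (by norm_num)
    apply mul_nonneg (sq_nonneg _); linarith
  linarith

lemma poly_typeI_n (n : ℝ) (h0 : 0 ≤ n) (h1 : n ≤ 1) :
    n*(1-n)^2/4 + (1-n)*n^2*(5/12) + 0.0512*n^3 ≤ 0.0962 := by
  nlinarith [mul_nonneg h0 (sq_nonneg (n-0.645)), sq_nonneg (n-0.645), mul_nonneg (sub_nonneg.2 h1) (sq_nonneg (n-0.645))]

lemma poly_B (ρ : ℝ) (h0 : 0 ≤ ρ) (h1 : ρ ≤ 1) :
    ρ^4/64 + ρ*(1-ρ)^2/4 + (1-ρ)*(5*ρ-1)^2/64 ≤ 0.0512 := by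
  nlinarith [mul_nonneg h0 (sq_nonneg (ρ-0.6)), sq_nonneg (ρ-0.6), mul_nonneg (sub_nonneg.2 h1) (sq_nonneg (ρ-0.6)), mul_nonneg h0 (sub_nonneg.2 h1), mul_nonneg (mul_nonneg h0 (sub_nonneg.2 h1)) (sq_nonneg (ρ-0.6)), sq_nonneg (ρ*(ρ-0.6))]

lemma poly_L2 (a e m h : ℝ) (ha : 0 ≤ a) (he : 0 ≤ e) (hm : 0 ≤ m) (hh : 0 ≤ h)
    (hs : a + e + 2*m + h = 1) :
    a*((1-a)^2/2 - e^2/2 - m^2) + e*(2*m*h + h^2/4 + m^2) + h*m^2 + m*(2*h-m)^2/8 ≤ 0.0962 := by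
  obtain ⟨n, hn⟩ : ∃ n, n = 2*m+h := ⟨_, rfl⟩
  have hn0 : 0 ≤ n := by rw [hn]; positivity
  have hn1 : n ≤ 1 := by linarith
  obtain ⟨ρ, hρ0, hρ1, hρ⟩ : ∃ ρ, 0 ≤ ρ ∧ ρ ≤ 1 ∧ h = ρ*n := by
    rcases eq_or_lt_of_le hn0 with h0 | h0
    · exact ⟨0, le_rfl, zero_le_one, by linarith⟩
    · refine ⟨h/n, by positivity, ?_, by field_simp⟩
      rw [div_le_one h0]; linarith
  have hm' : m = n*(1-ρ)/2 := by linarith [hn, hρ]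
  obtain ⟨δ, hδ⟩ : ∃ δ, δ = a - e := ⟨_, rfl⟩
  have ha' : a = (1-n+δ)/2 := by linarith
  have he' : e = (1-n-δ)/2 := by linarith
  have h1 := poly_B ρ hρ0 hρ1
  have h2 := poly_typeI_n n hn0 hn1
  have hA : 1/4 + ρ/2 - 3*ρ^2/8 ≤ 5/12 := by nlinarith [sq_nonneg (ρ-2/3)]
  have h3 := mul_le_mul_of_nonneg_left h1 (pow_nonneg hn0 3)
  have h4 := mul_le_mul_of_nonneg_left hA (mul_nonneg (sub_nonneg.2 hn1) (pow_nonneg hn0 2))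
  have h5 := mul_nonneg hn0 (sq_nonneg (δ/2 - ρ^2*n/8))
  subst ha' he'
  subst hm' hρ
  nlinarith [h2,h3,h4,h5]

lemma poly_typeI (a e p q f x r : ℝ) (ha : 0 ≤ a) (he : 0 ≤ e) (hp : 0 ≤ p) (hq : 0 ≤ q)
    (hf : 0 ≤ f) (hx : 0 ≤ x) (hr : 0 ≤ r) (hs : a+e+p+q+f+x+r = 1) :
    a*(e*(p+q+f+x+r) + p*(q+f+x+r) + q*(f+x+r) + f*(x+r) + x*r + r^2/2)
      + e*((p+q+x)*(f+r)+p*q+p*x+q*x) + (x+r)*(p*q+p*f+q*f) ≤ 0.0962 := by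
  have h := poly_L2 a e ((p+q)/2) (x+f+r) ha he (by positivity) (by positivity) (by linarith)
  refine le_trans ?_ h
  have hr' : a = 1 - (e+p+q+f+x+r) := by linarith
  have e1 : e*(p+q+f+x+r) + p*(q+f+x+r) + q*(f+x+r) + f*(x+r) + x*r + r^2/2
     = (1-a)^2/2 - e^2/2 - ((p+q)/2)^2 - ((p-q)/2)^2 - f^2/2 - x^2/2 := by
    rw [hr']; ring
  rw [e1]
  have i1 : a*((1-a)^2/2 - e^2/2 - ((p+q)/2)^2 - ((p-q)/2)^2 - f^2/2 - x^2/2)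
      ≤ a*((1-a)^2/2 - e^2/2 - ((p+q)/2)^2) := by
    apply mul_le_mul_of_nonneg_left _ ha; nlinarith [sq_nonneg (p-q)]
  have i2 : e*((p+q+x)*(f+r)+p*q+p*x+q*x) ≤
      e*(2*((p+q)/2)*(x+f+r) + (x+f+r)^2/4 + ((p+q)/2)^2) := by
    apply mul_le_mul_of_nonneg_left _ he
    nlinarith [sq_nonneg (p-q), sq_nonneg (x-f-r)]
  have i3 : (x+r)*(p*q+p*f+q*f) ≤ (x+f+r)*((p+q)/2)^2 + ((p+q)/2)*(2*(x+f+r)-(p+q)/2)^2/8 := by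
    have j1 : (x+r)*(p*q+p*f+q*f) ≤ (x+r)*(((p+q)/2)^2+(p+q)*f) := by
      apply mul_le_mul_of_nonneg_left _ (by positivity); nlinarith [sq_nonneg (p-q)]
    have j2 := mul_nonneg (show 0 ≤ (p+q)/2 by positivity) (sq_nonneg (2*(x+f+r)-(p+q)/2 - 4*f))
    nlinarith [j1,j2]
  linarith

lemma poly_K5 (x1 x2 u v w b : ℝ) (h1 : 0 ≤ x1) (h2 : 0 ≤ x2) (hu : 0 ≤ u) (hv : 0 ≤ v)
    (hw : 0 ≤ w) (hb : 0 ≤ b) (hs : x1+x2+u+v+w+b = 1) :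
    x1*x2*(u+v+w) + (x1+x2)*(u*v+u*w+v*w) + u*v*w
      + (x1*x2+(x1+x2)*(u+v+w)+(u*v+u*w+v*w))*b ≤ 0.0962 := by
  obtain ⟨τ, hτ⟩ : ∃ τ, τ = x1+x2+u+v+w := ⟨_, rfl⟩
  obtain ⟨E, hE⟩ : ∃ E, E = x1*x2+(x1+x2)*(u+v+w)+(u*v+u*w+v*w) := ⟨_, rfl⟩
  have hτ0 : 0 ≤ τ := by rw [hτ]; positivity
  have hE2 : E ≤ 2/5*τ^2 := by
    rw [hE, hτ]
    nlinarith [sq_nonneg (x1-x2), sq_nonneg (x1-u), sq_nonneg (x1-v), sq_nonneg (x1-w), sq_nonneg (x2-u), sq_nonneg (x2-v), sq_nonneg (x2-w), sq_nonneg (u-v), sq_nonneg (u-w), sq_nonneg (v-w)]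
  have hE3 : x1*x2*(u+v+w) + (x1+x2)*(u*v+u*w+v*w) + u*v*w ≤ τ*E/5 := by
    rw [hE, hτ]
    have T : ∀ x y z : ℝ, 0 ≤ x → 0 ≤ y → 0 ≤ z → 0 ≤ x*(y-z)^2 + y*(x-z)^2 + z*(x-y)^2 := by
      intros; positivity
    linarith [T x1 x2 u h1 h2 hu, T x1 x2 v h1 h2 hv, T x1 x2 w h1 h2 hw, T x1 u v h1 hu hv,
      T x1 u w h1 hu hw, T x1 v w h1 hv hw, T x2 u v h2 hu hv, T x2 u w h2 hu hw,
      T x2 v w h2 hv hw, T u v w hu hv hw]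
  have hb' : b = 1-τ := by linarith
  rw [← hE]
  have : τ*E/5 + E*b ≤ 2/5*τ^2*(1-4/5*τ) := by
    rw [hb']
    have : τ*E/5+E*(1-τ) = E*(1-4/5*τ) := by ring
    rw [this]
    apply mul_le_mul_of_nonneg_right hE2; linarith
  have : 2/5*τ^2*(1-4/5*τ) ≤ 0.0962 := by
    nlinarith [mul_nonneg hτ0 (sq_nonneg (τ-5/6)), sq_nonneg (τ-5/6)]
  linarith

lemma poly_small (x1 x2 u v w b : ℝ) (h1 : 0 ≤ x1) (h2 : 0 ≤ x2) (hu : 0 ≤ u) (hv : 0 ≤ v)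
    (hw : 0 ≤ w) (hb : 0 ≤ b) (hs : x1+x2+u+v+w+b = 1) (hsm : x1 + x2 ≤ 1/4) :
    x1*x2*(u+v+w+b) + (x1+x2)*(u*v+u*w+v*w+b^2/2+b*(u+v+w)) + (u*v+u*w+v*w)*b ≤ 0.0962 := by
  obtain ⟨s, hs'⟩ : ∃ s, s = x1+x2 := ⟨_, rfl⟩
  obtain ⟨t, ht⟩ : ∃ t, t = u+v+w := ⟨_, rfl⟩
  obtain ⟨E, hE⟩ : ∃ E, E = u*v+u*w+v*w := ⟨_, rfl⟩
  have hE2 : E ≤ t^2/3 := by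
    rw [hE, ht]; nlinarith [sq_nonneg (u-v), sq_nonneg (u-w), sq_nonneg (v-w)]
  have hx : x1*x2 ≤ s^2/4 := by rw [hs']; nlinarith [sq_nonneg (x1-x2)]
  have ht0 : 0 ≤ t := by rw [ht]; positivity
  have hs0 : 0 ≤ s := by rw [hs']; positivity
  rw [← hE, ← hs', ← ht]
  have hb' : b = 1 - s - t := by linarith
  have i1 : x1*x2*(t+b) ≤ s^2/4*(t+b) := mul_le_mul_of_nonneg_right hx (by positivity)
  have i2 : E*(s+b) ≤ t^2/3*(s+b) := mul_le_mul_of_nonneg_right hE2 (by positivity)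
  have hs4 : s ≤ 1/4 := by linarith
  have i3 : t^2*(2-3*s-2*t)/6 ≤ (2-3*s)^3/162 := by
    have := mul_nonneg (show 0 ≤ 2*t + (2-3*s)/3 by linarith) (sq_nonneg (t-(2-3*s)/3))
    nlinarith [this]
  have i4 : s*(1-s)*(2-s)/4 + (2-3*s)^3/162 ≤ 0.0962 := by
    nlinarith [mul_nonneg hs0 (sub_nonneg.2 hs4), mul_nonneg hs0 (mul_nonneg hs0 (sub_nonneg.2 hs4)), mul_nonneg (mul_nonneg hs0 (sub_nonneg.2 hs4)) (sub_nonneg.2 hs4)]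
  have : s^2/4*(t+b) + s*(b^2/2+b*t) + t^2/3*(s+b) = s*(1-s)*(2-s)/4 + t^2*(2-3*s-2*t)/6 := by
    rw [hb']; ring
  nlinarith [i1,i2,i3,i4,this]

lemma poly_A (s q p b : ℝ) (hs : 1/4 ≤ s) (hp : 0 ≤ p) (hq : 0 ≤ q) (hb : 0 ≤ b)
    (h : s + p + q + b = 1) : b*q*(p-s) ≤ s*q^2/2 + s*p^2/4 := by
  have hs0 : 0 ≤ s := by linarith
  rcases le_total p s with hps | hps
  · have : b*q*(p-s) ≤ 0 := mul_nonpos_of_nonneg_of_nonpos (by positivity) (by linarith)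
    have : 0 ≤ s*q^2/2 + s*p^2/4 := by positivity
    linarith
  · have k : b*(p-s) ≤ 7/10*(s*p) := by
      have : b*(p-s) ≤ (1-s-p)*(p-s) := mul_le_mul_of_nonneg_right (by linarith) (by linarith)
      have : (1-s-p)*(p-s) ≤ (3/4-p)*(p-1/4) := by nlinarith
      have : (3/4-p)*(p-1/4) ≤ 7/10*(1/4*p) := by nlinarith [sq_nonneg (p-0.4)]
      have : (1/4)*p ≤ s*p := mul_le_mul_of_nonneg_right hs hp
      linarith
    have := mul_le_mul_of_nonneg_left k hq
    have := mul_nonneg hs0 (sq_nonneg (q-7/10*p))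
    nlinarith [mul_nonneg hs0 (sq_nonneg p)]

lemma poly_Bc (s u p b : ℝ) (hs : 1/4 ≤ s) (hp : 0 ≤ p) (hu : 0 ≤ u) (hb : 0 ≤ b)
    (h : s + p + u + b = 1) : b*(p*(u-s) + p^2/4) ≤ s*u^2/2 + s*p^2/4 := by
  have hs0 : 0 ≤ s := by linarith
  have r1 : u^2/8 + p^2/16 ≤ s*u^2/2 + s*p^2/4 := by nlinarith [sq_nonneg u, sq_nonneg p]
  rcases le_total (u - s + p/4) 0 with hps | hps
  · have : b*p*(u-s+p/4) ≤ 0 := mul_nonpos_of_nonneg_of_nonpos (by positivity) (by linarith)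
    have : 0 ≤ s*u^2/2 + s*p^2/4 := by positivity
    nlinarith
  · have k : b*(u-s+p/4) ≤ (1/4-3*p/8)^2 := by
      have : b*(u-s+p/4) ≤ ((b + (u-s+p/4))/2)^2 := by nlinarith [sq_nonneg (b-(u-s+p/4))]
      have h2 : b + (u-s+p/4) = 1-2*s-3*p/4 := by linarith
      have : ((b + (u-s+p/4))/2)^2 ≤ (1/4-3*p/8)^2 := by
        apply pow_le_pow_left₀ (by positivity); linarith
      linarith
    have hp23 : p ≤ 2/3 := by linarith
    have := mul_le_mul_of_nonneg_left k hp
    have hu2 : ((1-p)/4)^2 ≤ u^2 := pow_le_pow_left₀ (by linarith) (by linarith) 2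
    have : p*(1/4-3*p/8)^2 ≤ (1-p)^2/128 + p^2/16 := by
      nlinarith [mul_nonneg hp (sq_nonneg (p-0.2)), sq_nonneg (p-0.2), mul_nonneg (sub_nonneg.2 hp23) (sq_nonneg (p-0.2)), mul_nonneg hp (sub_nonneg.2 hp23)]
    nlinarith

lemma poly_core (s u v w b c3 c4 c5 : ℝ) (hs : 1/4 ≤ s) (hu : 0 ≤ u) (hv : 0 ≤ v)
    (hw : 0 ≤ w) (hb : 0 ≤ b) (h : s + u + v + w + b = 1)
    (h3 : c3 = 0 ∨ c3 = 1) (h4 : c4 = 0 ∨ c4 = 1) (h5 : c5 = 0 ∨ c5 = 1) :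
    b*(s*(u*c3+v*c4+w*c5) + (u*v*(1-c3*c4)+u*w*(1-c3*c5)+v*w*(1-c4*c5)))
      ≤ b*s*(u+v+w) + s*(u^2+v^2+w^2)/2 := by
  have A : ∀ u v w : ℝ, 0 ≤ u → 0 ≤ v → 0 ≤ w → s+u+v+w+b=1 →
      b*u*(v+w-s) ≤ s*(u^2+v^2+w^2)/2 := by
    intro u v w hu hv hw h
    have := poly_A s u (v+w) b hs (by positivity) hu hb (by linarith)
    nlinarith [mul_nonneg (show 0 ≤ s by linarith) (sq_nonneg (v-w))]
  have B : ∀ u v w : ℝ, 0 ≤ u → 0 ≤ v → 0 ≤ w → s+u+v+w+b=1 →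
      b*((v+w)*(u-s)+v*w) ≤ s*(u^2+v^2+w^2)/2 := by
    intro u v w hu hv hw h
    have := poly_Bc s u (v+w) b hs (by positivity) hu hb (by linarith)
    nlinarith [mul_nonneg (show 0 ≤ s by linarith) (sq_nonneg (v-w)), mul_nonneg hb (sq_nonneg (v-w))]
  have hs0 : 0 ≤ s := by linarith
  have a1 := A u v w hu hv hw h
  have a2 := A v u w hv hu hw (by linarith)
  have a3 := A w u v hw hu hv (by linarith)
  have b1 := B u v w hu hv hw h
  have b2 := B v u w hv hu hw (by linarith)
  have b3 := B w u v hw hu hv (by linarith)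
  have z : 0 ≤ s*(u^2+v^2+w^2)/2 := by positivity
  have z1 : 0 ≤ b*s*u := by positivity
  rcases h3 with rfl | rfl <;> rcases h4 with rfl | rfl <;> rcases h5 with rfl | rfl <;> nlinarith

noncomputable def SS (E : Finset (Finset ℕ)) (w : ℕ → ℝ) (k : ℕ) (A W : Finset ℕ) : ℝ :=
  ∑ p ∈ powersetCard k W, if A ∪ p ∈ E then ∏ v ∈ p, w v else 0

lemma SS_split (E : Finset (Finset ℕ)) (w : ℕ → ℝ) (k : ℕ) (A W : Finset ℕ) (v : ℕ)
    (hv : v ∉ W) :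
    SS E w (k+1) A (insert v W) = SS E w (k+1) A W + w v * SS E w k (insert v A) W := by
  unfold SS
  rw [Finset.powersetCard_succ_insert hv, Finset.sum_union]
  · congr 1
    rw [Finset.sum_image, Finset.mul_sum]
    · apply Finset.sum_congr rfl
      intro p hp
      have hvp : v ∉ p := fun h => hv ((Finset.mem_powersetCard.1 hp).1 h)
      have : A ∪ insert v p = insert v A ∪ p := by ext; simp
      rw [this, Finset.prod_insert hvp]
      split_ifs <;> simp
    · intro p hp q hq hpq
      have hvp : v ∉ p := fun h => hv ((Finset.mem_powersetCard.1 hp).1 h)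
      have hvq : v ∉ q := fun h => hv ((Finset.mem_powersetCard.1 hq).1 h)
      have := congrArg (fun s => Finset.erase s v) hpq
      simpa [hvp, hvq] using this
  · rw [Finset.disjoint_left]
    intro p hp hp'
    obtain ⟨q, _, rfl⟩ := Finset.mem_image.1 hp'
    exact hv ((Finset.mem_powersetCard.1 hp).1 (Finset.mem_insert_self _ _))

lemma SS_zero_card (E : Finset (Finset ℕ)) (w : ℕ → ℝ) (A W : Finset ℕ) :
    SS E w 0 A W = if A ∈ E then 1 else 0 := by
  simp [SS]

lemma SS_one (E : Finset (Finset ℕ)) (w : ℕ → ℝ) (A W : Finset ℕ) :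
    SS E w 1 A W = ∑ y ∈ W, w y * (if insert y A ∈ E then 1 else 0) := by
  unfold SS
  rw [Finset.powersetCard_one, Finset.sum_map]
  apply Finset.sum_congr rfl
  intro y _
  have : A ∪ {y} = insert y A := by ext; simp
  simp [this]

lemma SS_nonneg (E : Finset (Finset ℕ)) (w : ℕ → ℝ) (k : ℕ) (A W : Finset ℕ)
    (hw : ∀ v ∈ W, 0 ≤ w v) : 0 ≤ SS E w k A W := by
  apply Finset.sum_nonneg
  intro p hp
  split_ifs
  · exact Finset.prod_nonneg fun v hv => hw v ((Finset.mem_powersetCard.1 hp).1 hv)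
  · exact le_rfl

lemma SS_zero_le (E : Finset (Finset ℕ)) (w : ℕ → ℝ) (A W : Finset ℕ) :
    SS E w 0 A W ≤ 1 := by
  rw [SS_zero_card]; split_ifs <;> norm_num

lemma SS_one_le (E : Finset (Finset ℕ)) (w : ℕ → ℝ) (A W : Finset ℕ)
    (hw : ∀ v ∈ W, 0 ≤ w v) : SS E w 1 A W ≤ ∑ y ∈ W, w y := by
  rw [SS_one]
  apply Finset.sum_le_sum
  intro y hy
  have := hw y hy
  split_ifs <;> simp [this]

lemma SS_two_le (E : Finset (Finset ℕ)) (w : ℕ → ℝ) (W : Finset ℕ) :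
    (∀ v ∈ W, 0 ≤ w v) → ∀ A, SS E w 2 A W ≤ (∑ y ∈ W, w y)^2/2 := by
  induction W using Finset.induction_on with
  | empty => intro _ A; simp [SS, show powersetCard 2 (∅ : Finset ℕ) = ∅ from rfl]
  | insert v W hv ih =>
    intro hw A
    have hw' : ∀ v ∈ W, 0 ≤ w v := fun u hu => hw u (Finset.mem_insert_of_mem hu)
    have h0 := hw v (Finset.mem_insert_self _ _)
    rw [SS_split E w 1 A W v hv, Finset.sum_insert hv]
    have h1 := ih hw' A
    have h2 := mul_le_mul_of_nonneg_left (SS_one_le E w (insert v A) W hw') h0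
    nlinarith [sq_nonneg (w v)]

lemma SS_eq_zero (E : Finset (Finset ℕ)) (w : ℕ → ℝ) (k : ℕ) (A W Q : Finset ℕ)
    (hQ : ∀ e ∈ E, ¬ Disjoint e Q) (h : Disjoint (A ∪ W) Q) : SS E w k A W = 0 := by
  apply Finset.sum_eq_zero
  intro p hp
  rw [if_neg]
  intro he
  exact hQ _ he (h.mono_left (Finset.union_subset_union_right (Finset.mem_powersetCard.1 hp).1))

lemma lagFun_eq_SS (G : ThreeGraph) (w : ℕ → ℝ) : G.lagFun w = SS G.edges w 3 ∅ G.verts := by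
  unfold HyperGraph.lagFun SS
  rw [← Finset.sum_filter]
  apply Finset.sum_congr _ (fun _ _ => rfl)
  ext e
  simp only [Finset.mem_filter, Finset.mem_powersetCard, Finset.empty_union]
  exact ⟨fun h => ⟨⟨G.edges_sub e h, G.card_eq e h⟩, h⟩, fun h => h.2⟩

/-- Every set of four vertices spanning a complete 3-graph meets every edge. -/
def Hit (E : Finset (Finset ℕ)) : Prop :=
  ∀ p q r s : ℕ, [p, q, r, s].Nodup → {p, q, r} ∈ E → {p, q, s} ∈ E → {p, r, s} ∈ E →
    {q, r, s} ∈ E → ∀ e ∈ E, ¬ Disjoint e {p, q, r, s}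

lemma hit_of_free (G : ThreeGraph) (hfree : G.Free K43e) : Hit G.edges := by
  intro p q r s hn h1 h2 h3 h4 e he hd
  apply hfree
  obtain ⟨a, b, c, hab, hac, hbc, rfl⟩ := Finset.card_eq_three.1 (G.card_eq e he)
  have m1 := G.edges_sub _ h1
  have m2 := G.edges_sub _ h2
  have m3 := G.edges_sub _ he
  simp only [Finset.insert_subset_iff, Finset.singleton_subset_iff] at m1 m2 m3
  simp only [Finset.disjoint_left, Finset.mem_insert, Finset.mem_singleton] at hd
  simp only [List.nodup_cons, List.mem_cons, List.not_mem_nil, or_false, not_or] at hn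
  let f : ℕ → ℕ := fun n => if n = 1 then p else if n = 2 then q else if n = 3 then r
    else if n = 4 then s else if n = 5 then a else if n = 6 then b else c
  have hda := hd (a := a) (by simp)
  have hdb := hd (a := b) (by simp)
  have hdc := hd (a := c) (by simp)
  refine ⟨f, ?_, ?_, ?_⟩
  · intro i hi j hj hij
    simp only [K43e, Finset.coe_insert, Finset.coe_singleton, Set.mem_insert_iff,
      Set.mem_singleton_iff] at hi hj
    rcases hi with rfl | rfl | rfl | rfl | rfl | rfl | rfl <;>
    rcases hj with rfl | rfl | rfl | rfl | rfl | rfl | rfl <;>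
    simp [f] at hij ⊢ <;> grind
  · intro i hi
    simp only [K43e, Finset.mem_insert, Finset.mem_singleton] at hi
    rcases hi with rfl | rfl | rfl | rfl | rfl | rfl | rfl <;> simp [f, m1, m2, m3]
  · intro i hi
    simp only [K43e, Finset.mem_insert, Finset.mem_singleton] at hi
    rcases hi with rfl | rfl | rfl | rfl | rfl <;> simp [f, Finset.image_insert, *]

structure Cfg (E : Finset (Finset ℕ)) (v1 v2 v3 v4 v5 : ℕ) : Prop where
  nd : [v1, v2, v3, v4, v5].Nodup
  h123 : {v1, v2, v3} ∈ E
  h124 : {v1, v2, v4} ∈ E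
  h125 : {v1, v2, v5} ∈ E
  h134 : {v1, v3, v4} ∈ E
  h135 : {v1, v3, v5} ∈ E
  h145 : {v1, v4, v5} ∈ E
  h234 : {v2, v3, v4} ∈ E
  h235 : {v2, v3, v5} ∈ E
  h245 : {v2, v4, v5} ∈ E

lemma tri_swap {E : Finset (Finset ℕ)} {a b c : ℕ} (h : {a, b, c} ∈ E) : {b, a, c} ∈ E := by
  rwa [Finset.insert_comm]

lemma tri_swap2 {E : Finset (Finset ℕ)} {a b c : ℕ} (h : {a, b, c} ∈ E) : {a, c, b} ∈ E := by
  rwa [Finset.pair_comm]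

lemma Cfg.swap12 {E v1 v2 v3 v4 v5} (h : Cfg E v1 v2 v3 v4 v5) : Cfg E v2 v1 v3 v4 v5 where
  nd := by have := h.nd; grind
  h123 := tri_swap h.h123
  h124 := tri_swap h.h124
  h125 := tri_swap h.h125
  h134 := h.h234
  h135 := h.h235
  h145 := h.h245
  h234 := h.h134
  h235 := h.h135
  h245 := h.h145

lemma Cfg.swap34 {E v1 v2 v3 v4 v5} (h : Cfg E v1 v2 v3 v4 v5) : Cfg E v1 v2 v4 v3 v5 where
  nd := by have := h.nd; grind
  h123 := h.h124
  h124 := h.h123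
  h125 := h.h125
  h134 := tri_swap2 h.h134
  h135 := h.h145
  h145 := h.h135
  h234 := tri_swap2 h.h234
  h235 := h.h245
  h245 := h.h235

lemma Cfg.swap45 {E v1 v2 v3 v4 v5} (h : Cfg E v1 v2 v3 v4 v5) : Cfg E v1 v2 v3 v5 v4 where
  nd := by have := h.nd; grind
  h123 := h.h123
  h124 := h.h125
  h125 := h.h124
  h134 := h.h135
  h135 := h.h134
  h145 := tri_swap2 h.h145
  h234 := h.h235
  h235 := h.h234
  h245 := tri_swap2 h.h245

lemma expand5 (E : Finset (Finset ℕ)) (w : ℕ → ℝ) (v1 v2 v3 v4 v5 : ℕ) (B : Finset ℕ)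
    (nd : [v1, v2, v3, v4, v5].Nodup) (n1 : v1 ∉ B) (n2 : v2 ∉ B) (n3 : v3 ∉ B) (n4 : v4 ∉ B)
    (n5 : v5 ∉ B) :
    SS E w 3 ∅ (insert v1 (insert v2 (insert v3 (insert v4 (insert v5 B))))) =
    SS E w 3 ∅ B
    + (w v1 * SS E w 2 {v1} B + w v2 * SS E w 2 {v2} B + w v3 * SS E w 2 {v3} B
      + w v4 * SS E w 2 {v4} B + w v5 * SS E w 2 {v5} B)
    + (w v1 * w v2 * SS E w 1 {v2, v1} B
      + (w v1 * w v3 * SS E w 1 {v3, v1} B + w v1 * w v4 * SS E w 1 {v4, v1} B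
        + w v1 * w v5 * SS E w 1 {v5, v1} B)
      + (w v2 * w v3 * SS E w 1 {v3, v2} B + w v2 * w v4 * SS E w 1 {v4, v2} B
        + w v2 * w v5 * SS E w 1 {v5, v2} B)
      + (w v3 * w v4 * SS E w 1 {v4, v3} B + w v3 * w v5 * SS E w 1 {v5, v3} B
        + w v4 * w v5 * SS E w 1 {v5, v4} B))
    + (w v1 * w v2 * w v3 * SS E w 0 {v3, v2, v1} B + w v1 * w v2 * w v4 * SS E w 0 {v4, v2, v1} B
      + w v1 * w v2 * w v5 * SS E w 0 {v5, v2, v1} B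
      + w v1 * w v3 * w v4 * SS E w 0 {v4, v3, v1} B + w v1 * w v3 * w v5 * SS E w 0 {v5, v3, v1} B
      + w v1 * w v4 * w v5 * SS E w 0 {v5, v4, v1} B
      + w v2 * w v3 * w v4 * SS E w 0 {v4, v3, v2} B + w v2 * w v3 * w v5 * SS E w 0 {v5, v3, v2} B
      + w v2 * w v4 * w v5 * SS E w 0 {v5, v4, v2} B
      + w v3 * w v4 * w v5 * SS E w 0 {v5, v4, v3} B) := by
  have z : ∀ A W, SS E w 0 A W = SS E w 0 A B := by intro A W; simp [SS_zero_card]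
  have m5 := n5
  have m4 : v4 ∉ insert v5 B := by grind
  have m3 : v3 ∉ insert v4 (insert v5 B) := by grind
  have m2 : v2 ∉ insert v3 (insert v4 (insert v5 B)) := by grind
  have m1 : v1 ∉ insert v2 (insert v3 (insert v4 (insert v5 B))) := by grind
  have s5 := fun k A => SS_split E w k A _ _ m5
  have s4 := fun k A => SS_split E w k A _ _ m4
  have s3 := fun k A => SS_split E w k A _ _ m3
  have s2 := fun k A => SS_split E w k A _ _ m2
  have s1 := fun k A => SS_split E w k A _ _ m1
  rw [s1 2]
  simp only [s2 2, s2 1]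
  simp only [s3 2, s3 1, s3 0]
  simp only [s4 2, s4 1, s4 0]
  simp only [s5 2, s5 1, s5 0]
  simp only [z _ (insert _ _), insert_empty_eq]
  ring

lemma SS_eq_zero4 (E : Finset (Finset ℕ)) (w : ℕ → ℝ) (k : ℕ) (A W : Finset ℕ) (p q r s : ℕ)
    (hQ : ∀ e ∈ E, ¬ Disjoint e {p, q, r, s}) (hA : p ∉ A ∧ q ∉ A ∧ r ∉ A ∧ s ∉ A)
    (hW : p ∉ W ∧ q ∉ W ∧ r ∉ W ∧ s ∉ W) : SS E w k A W = 0 := by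
  apply SS_eq_zero E w k A W _ hQ
  simp [Finset.disjoint_union_left, Finset.disjoint_insert_right, hA, hW]

lemma ne5 {a b c d e : ℕ} (h : [a, b, c, d, e].Nodup) :
    (a ≠ b ∧ a ≠ c ∧ a ≠ d ∧ a ≠ e ∧ b ≠ c ∧ b ≠ d ∧ b ≠ e ∧ c ≠ d ∧ c ≠ e ∧ d ≠ e) ∧
    (b ≠ a ∧ c ≠ a ∧ d ≠ a ∧ e ≠ a ∧ c ≠ b ∧ d ≠ b ∧ e ≠ b ∧ d ≠ c ∧ e ≠ c ∧ e ≠ d) := by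
  simp only [List.nodup_cons, List.mem_cons, List.not_mem_nil, or_false, not_or] at h
  omega

lemma split_verts (V : Finset ℕ) (a b c d e : ℕ) (h : a ∈ V ∧ b ∈ V ∧ c ∈ V ∧ d ∈ V ∧ e ∈ V) :
    V = insert a (insert b (insert c (insert d (insert e (V \ {a, b, c, d, e}))))) := by
  ext v
  simp only [Finset.mem_insert, Finset.mem_sdiff, Finset.mem_singleton]
  obtain ⟨ha, hb, hc, hd, he⟩ := h
  constructor
  · intro hv; tauto
  · rintro (rfl | rfl | rfl | rfl | rfl | hv)
    all_goals first | assumption | exact hv.1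

lemma sum_insert5 (w : ℕ → ℝ) (B : Finset ℕ) (a b c d e : ℕ) (h : [a, b, c, d, e].Nodup)
    (n1 : a ∉ B) (n2 : b ∉ B) (n3 : c ∉ B) (n4 : d ∉ B) (n5 : e ∉ B) :
    ∑ y ∈ insert a (insert b (insert c (insert d (insert e B)))), w y =
      w a + w b + w c + w d + w e + ∑ y ∈ B, w y := by
  have hn := ne5 h
  rw [Finset.sum_insert (by simp [hn, n1]), Finset.sum_insert (by simp [hn, n2]),
    Finset.sum_insert (by simp [hn, n3]), Finset.sum_insert (by simp [hn, n4]),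
    Finset.sum_insert n5]
  ring

lemma case_K5 (E : Finset (Finset ℕ)) (w : ℕ → ℝ) (v1 v2 v3 v4 v5 : ℕ) (B : Finset ℕ)
    (hE : Hit E) (hc : Cfg E v1 v2 v3 v4 v5) (n1 : v1 ∉ B) (n2 : v2 ∉ B) (n3 : v3 ∉ B)
    (n4 : v4 ∉ B) (n5 : v5 ∉ B) (w1 : 0 ≤ w v1) (w2 : 0 ≤ w v2) (w3 : 0 ≤ w v3)
    (w4 : 0 ≤ w v4) (w5 : 0 ≤ w v5) (wB : ∀ v ∈ B, 0 ≤ w v)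
    (hs : w v1 + w v2 + w v3 + w v4 + w v5 + ∑ y ∈ B, w y = 1) (h345 : {v3, v4, v5} ∈ E) :
    SS E w 3 ∅ (insert v1 (insert v2 (insert v3 (insert v4 (insert v5 B))))) ≤ 0.0962 := by
  have nd := hc.nd
  have hn := ne5 nd
  have b0 : 0 ≤ ∑ y ∈ B, w y := Finset.sum_nonneg wB
  rw [expand5 E w v1 v2 v3 v4 v5 B nd n1 n2 n3 n4 n5]
  have q1 := hE v1 v2 v3 v4 (by simp [hn]) hc.h123 hc.h124 hc.h134 hc.h234
  have q2 := hE v1 v2 v3 v5 (by simp [hn]) hc.h123 hc.h125 hc.h135 hc.h235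
  have q3 := hE v1 v2 v4 v5 (by simp [hn]) hc.h124 hc.h125 hc.h145 hc.h245
  have q4 := hE v1 v3 v4 v5 (by simp [hn]) hc.h134 hc.h135 hc.h145 h345
  have q5 := hE v2 v3 v4 v5 (by simp [hn]) hc.h234 hc.h235 hc.h245 h345
  rw [SS_eq_zero4 E w 3 ∅ B _ _ _ _ q1 (by simp [hn]) (by simp [n1, n2, n3, n4, n5]),
    SS_eq_zero4 E w 2 {v1} B _ _ _ _ q5 (by simp [hn]) (by simp [n1, n2, n3, n4, n5]),
    SS_eq_zero4 E w 2 {v2} B _ _ _ _ q4 (by simp [hn]) (by simp [n1, n2, n3, n4, n5]),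
    SS_eq_zero4 E w 2 {v3} B _ _ _ _ q3 (by simp [hn]) (by simp [n1, n2, n3, n4, n5]),
    SS_eq_zero4 E w 2 {v4} B _ _ _ _ q2 (by simp [hn]) (by simp [n1, n2, n3, n4, n5]),
    SS_eq_zero4 E w 2 {v5} B _ _ _ _ q1 (by simp [hn]) (by simp [n1, n2, n3, n4, n5])]
  refine le_trans ?_ (poly_K5 (w v1) (w v2) (w v3) (w v4) (w v5) _ w1 w2 w3 w4 w5 b0 hs)
  have o : ∀ x y A, 0 ≤ x → 0 ≤ y → x * y * SS E w 1 A B ≤ x * y * ∑ y ∈ B, w y :=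
    fun x y A hx hy => mul_le_mul_of_nonneg_left (SS_one_le E w A B wB) (mul_nonneg hx hy)
  have z : ∀ x y t A, 0 ≤ x → 0 ≤ y → 0 ≤ t → x * y * t * SS E w 0 A B ≤ x * y * t := by
    intro x y t A hx hy ht
    exact mul_le_of_le_one_right (by positivity) (SS_zero_le E w A B)
  linarith [o _ _ {v2, v1} w1 w2, o _ _ {v3, v1} w1 w3, o _ _ {v4, v1} w1 w4,
    o _ _ {v5, v1} w1 w5, o _ _ {v3, v2} w2 w3, o _ _ {v4, v2} w2 w4, o _ _ {v5, v2} w2 w5,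
    o _ _ {v4, v3} w3 w4, o _ _ {v5, v3} w3 w5, o _ _ {v5, v4} w4 w5,
    z _ _ _ {v3, v2, v1} w1 w2 w3, z _ _ _ {v4, v2, v1} w1 w2 w4, z _ _ _ {v5, v2, v1} w1 w2 w5,
    z _ _ _ {v4, v3, v1} w1 w3 w4, z _ _ _ {v5, v3, v1} w1 w3 w5, z _ _ _ {v5, v4, v1} w1 w4 w5,
    z _ _ _ {v4, v3, v2} w2 w3 w4, z _ _ _ {v5, v3, v2} w2 w3 w5, z _ _ _ {v5, v4, v2} w2 w4 w5,
    z _ _ _ {v5, v4, v3} w3 w4 w5]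

/-- A general bound when `345` is not an edge. -/
lemma bound_general (E : Finset (Finset ℕ)) (w : ℕ → ℝ) (v1 v2 v3 v4 v5 : ℕ) (B : Finset ℕ)
    (hE : Hit E) (hc : Cfg E v1 v2 v3 v4 v5) (n1 : v1 ∉ B) (n2 : v2 ∉ B) (n3 : v3 ∉ B)
    (n4 : v4 ∉ B) (n5 : v5 ∉ B) (w1 : 0 ≤ w v1) (w2 : 0 ≤ w v2) (w3 : 0 ≤ w v3)
    (w4 : 0 ≤ w v4) (w5 : 0 ≤ w v5) (wB : ∀ v ∈ B, 0 ≤ w v) (h345 : {v3, v4, v5} ∉ E) :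
    SS E w 3 ∅ (insert v1 (insert v2 (insert v3 (insert v4 (insert v5 B))))) ≤
    w v1 * SS E w 2 {v1} B + w v2 * SS E w 2 {v2} B
    + w v1 * w v2 * ∑ y ∈ B, w y
    + ((w v1 * w v3 * SS E w 1 {v3, v1} B + w v1 * w v4 * SS E w 1 {v4, v1} B
        + w v1 * w v5 * SS E w 1 {v5, v1} B)
      + (w v2 * w v3 * SS E w 1 {v3, v2} B + w v2 * w v4 * SS E w 1 {v4, v2} B
        + w v2 * w v5 * SS E w 1 {v5, v2} B)
      + (w v3 * w v4 * SS E w 1 {v4, v3} B + w v3 * w v5 * SS E w 1 {v5, v3} B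
        + w v4 * w v5 * SS E w 1 {v5, v4} B))
    + w v1 * w v2 * (w v3 + w v4 + w v5)
    + (w v1 + w v2) * (w v3 * w v4 + w v3 * w v5 + w v4 * w v5) := by
  have nd := hc.nd
  have hn := ne5 nd
  rw [expand5 E w v1 v2 v3 v4 v5 B nd n1 n2 n3 n4 n5]
  have q1 := hE v1 v2 v3 v4 (by simp [hn]) hc.h123 hc.h124 hc.h134 hc.h234
  have q2 := hE v1 v2 v3 v5 (by simp [hn]) hc.h123 hc.h125 hc.h135 hc.h235
  have q3 := hE v1 v2 v4 v5 (by simp [hn]) hc.h124 hc.h125 hc.h145 hc.h245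
  have h543 : {v5, v4, v3} ∉ E := fun h => h345 (tri_swap (tri_swap2 (tri_swap h)))
  rw [SS_eq_zero4 E w 3 ∅ B _ _ _ _ q1 (by simp [hn]) (by simp [n1, n2, n3, n4, n5]),
    SS_eq_zero4 E w 2 {v3} B _ _ _ _ q3 (by simp [hn]) (by simp [n1, n2, n3, n4, n5]),
    SS_eq_zero4 E w 2 {v4} B _ _ _ _ q2 (by simp [hn]) (by simp [n1, n2, n3, n4, n5]),
    SS_eq_zero4 E w 2 {v5} B _ _ _ _ q1 (by simp [hn]) (by simp [n1, n2, n3, n4, n5]),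
    SS_zero_card E w {v5, v4, v3}, if_neg h543]
  have o : ∀ x y A, 0 ≤ x → 0 ≤ y → x * y * SS E w 1 A B ≤ x * y * ∑ y ∈ B, w y :=
    fun x y A hx hy => mul_le_mul_of_nonneg_left (SS_one_le E w A B wB) (mul_nonneg hx hy)
  have z : ∀ x y t A, 0 ≤ x → 0 ≤ y → 0 ≤ t → x * y * t * SS E w 0 A B ≤ x * y * t := by
    intro x y t A hx hy ht
    exact mul_le_of_le_one_right (by positivity) (SS_zero_le E w A B)
  linarith [o _ _ {v2, v1} w1 w2,
    z _ _ _ {v3, v2, v1} w1 w2 w3, z _ _ _ {v4, v2, v1} w1 w2 w4, z _ _ _ {v5, v2, v1} w1 w2 w5,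
    z _ _ _ {v4, v3, v1} w1 w3 w4, z _ _ _ {v5, v3, v1} w1 w3 w5, z _ _ _ {v5, v4, v1} w1 w4 w5,
    z _ _ _ {v4, v3, v2} w2 w3 w4, z _ _ _ {v5, v3, v2} w2 w3 w5, z _ _ _ {v5, v4, v2} w2 w4 w5]

lemma case_small (E : Finset (Finset ℕ)) (w : ℕ → ℝ) (v1 v2 v3 v4 v5 : ℕ) (B : Finset ℕ)
    (hE : Hit E) (hc : Cfg E v1 v2 v3 v4 v5) (n1 : v1 ∉ B) (n2 : v2 ∉ B) (n3 : v3 ∉ B)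
    (n4 : v4 ∉ B) (n5 : v5 ∉ B) (w1 : 0 ≤ w v1) (w2 : 0 ≤ w v2) (w3 : 0 ≤ w v3)
    (w4 : 0 ≤ w v4) (w5 : 0 ≤ w v5) (wB : ∀ v ∈ B, 0 ≤ w v)
    (hs : w v1 + w v2 + w v3 + w v4 + w v5 + ∑ y ∈ B, w y = 1) (h345 : {v3, v4, v5} ∉ E)
    (hsm : w v1 + w v2 ≤ 1/4) :
    SS E w 3 ∅ (insert v1 (insert v2 (insert v3 (insert v4 (insert v5 B))))) ≤ 0.0962 := by
  have b0 : 0 ≤ ∑ y ∈ B, w y := Finset.sum_nonneg wB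
  refine le_trans (bound_general E w v1 v2 v3 v4 v5 B hE hc n1 n2 n3 n4 n5 w1 w2 w3 w4 w5 wB h345) ?_
  refine le_trans ?_ (poly_small (w v1) (w v2) (w v3) (w v4) (w v5) _ w1 w2 w3 w4 w5 b0 hs hsm)
  have o : ∀ x y A, 0 ≤ x → 0 ≤ y → x * y * SS E w 1 A B ≤ x * y * ∑ y ∈ B, w y :=
    fun x y A hx hy => mul_le_mul_of_nonneg_left (SS_one_le E w A B wB) (mul_nonneg hx hy)
  linarith [o _ _ {v3, v1} w1 w3, o _ _ {v4, v1} w1 w4,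
    o _ _ {v5, v1} w1 w5, o _ _ {v3, v2} w2 w3, o _ _ {v4, v2} w2 w4, o _ _ {v5, v2} w2 w5,
    o _ _ {v4, v3} w3 w4, o _ _ {v5, v3} w3 w5, o _ _ {v5, v4} w4 w5,
    mul_le_mul_of_nonneg_left (SS_two_le E w B wB {v1}) w1,
    mul_le_mul_of_nonneg_left (SS_two_le E w B wB {v2}) w2]

lemma case_typeI (E : Finset (Finset ℕ)) (w : ℕ → ℝ) (v1 v2 v3 v4 v5 : ℕ) (B : Finset ℕ)
    (hE : Hit E) (hc : Cfg E v1 v2 v3 v4 v5) (n1 : v1 ∉ B) (n2 : v2 ∉ B) (n3 : v3 ∉ B)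
    (n4 : v4 ∉ B) (n5 : v5 ∉ B) (w1 : 0 ≤ w v1) (w2 : 0 ≤ w v2) (w3 : 0 ≤ w v3)
    (w4 : 0 ≤ w v4) (w5 : 0 ≤ w v5) (wB : ∀ v ∈ B, 0 ≤ w v)
    (hs : w v1 + w v2 + w v3 + w v4 + w v5 + ∑ y ∈ B, w y = 1) (h345 : {v3, v4, v5} ∉ E)
    (x : ℕ) (hx : x ∈ B) (h34x : {v3, v4, x} ∈ E) (h13x : {v1, v3, x} ∈ E)
    (h14x : {v1, v4, x} ∈ E) :
    SS E w 3 ∅ (insert v1 (insert v2 (insert v3 (insert v4 (insert v5 B))))) ≤ 0.0962 := by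
  refine le_trans (bound_general E w v1 v2 v3 v4 v5 B hE hc n1 n2 n3 n4 n5 w1 w2 w3 w4 w5 wB h345) ?_
  have nd := hc.nd
  have hn := ne5 nd
  obtain ⟨R, hxR, rfl⟩ : ∃ R, x ∉ R ∧ B = insert x R :=
    ⟨B.erase x, Finset.notMem_erase _ _, (Finset.insert_erase hx).symm⟩
  have wx := wB x hx
  have wR : ∀ v ∈ R, 0 ≤ w v := fun v hv => wB v (Finset.mem_insert_of_mem hv)
  have r0 : 0 ≤ ∑ y ∈ R, w y := Finset.sum_nonneg wR
  simp only [Finset.mem_insert, not_or] at n1 n2 n3 n4 n5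
  have q := hE v1 v3 v4 x (by simp [hn, n1, n3, n4]) hc.h134 h13x h14x h34x
  have sx := fun k A => SS_split E w k A R x hxR
  have z2 := SS_eq_zero4 E w 2 {v2} R _ _ _ _ q (by simp [hn, n2.1, n5.1, Ne.symm n2.1, Ne.symm n5.1])
    (by simp [n1, n3, n4, hxR])
  have z1 := SS_eq_zero4 E w 1 {v5, v2} R _ _ _ _ q (by simp [hn, n2.1, n5.1, Ne.symm n2.1, Ne.symm n5.1])
    (by simp [n1, n3, n4, hxR])
  rw [Finset.sum_insert hxR] at hs ⊢
  have o' : ∀ A, SS E w 1 A (insert x R) ≤ w x + ∑ y ∈ R, w y := by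
    intro A
    rw [← Finset.sum_insert hxR]
    exact SS_one_le E w A _ wB
  have o : ∀ a b A, 0 ≤ a → 0 ≤ b →
      a * b * SS E w 1 A (insert x R) ≤ a * b * (w x + ∑ y ∈ R, w y) :=
    fun a b A ha hb => mul_le_mul_of_nonneg_left (o' A) (mul_nonneg ha hb)
  have t1 : SS E w 2 {v1} (insert x R) ≤ w x * (∑ y ∈ R, w y) + (∑ y ∈ R, w y)^2/2 := by
    rw [sx 1]
    linarith [SS_two_le E w R wR {v1},
      mul_le_mul_of_nonneg_left (SS_one_le E w (insert x {v1}) R wR) wx]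
  have t2 : SS E w 2 {v2} (insert x R) ≤ w x * (∑ y ∈ R, w y) := by
    rw [sx 1, z2]
    linarith [mul_le_mul_of_nonneg_left (SS_one_le E w (insert x {v2}) R wR) wx]
  have t3 : SS E w 1 {v5, v2} (insert x R) ≤ w x := by
    rw [sx 0, z1]
    linarith [mul_le_mul_of_nonneg_left (SS_zero_le E w (insert x {v5, v2}) R) wx]
  refine le_trans ?_ (poly_typeI (w v1) (w v2) (w v3) (w v4) (w v5) (w x) _ w1 w2 w3 w4 w5 wx r0
    (by linarith))
  linarith [o _ _ {v3, v1} w1 w3, o _ _ {v4, v1} w1 w4,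
    o _ _ {v5, v1} w1 w5, o _ _ {v3, v2} w2 w3, o _ _ {v4, v2} w2 w4,
    mul_le_mul_of_nonneg_left t3 (mul_nonneg w2 w5),
    o _ _ {v4, v3} w3 w4, o _ _ {v5, v3} w3 w5, o _ _ {v5, v4} w4 w5,
    mul_le_mul_of_nonneg_left t1 w1, mul_le_mul_of_nonneg_left t2 w2]

lemma poly_per_vertex (x1 x2 u v w b c3 c4 c5 d3 d4 d5 g34 g35 g45 : ℝ) (h1 : 0 ≤ x1) (h2 : 0 ≤ x2)
    (hs : 1/4 ≤ x1 + x2) (hu : 0 ≤ u) (hv : 0 ≤ v)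
    (hw : 0 ≤ w) (hb : 0 ≤ b) (h : x1 + x2 + u + v + w + b = 1)
    (h3 : c3 = 0 ∨ c3 = 1) (h4 : c4 = 0 ∨ c4 = 1) (h5 : c5 = 0 ∨ c5 = 1)
    (h3' : d3 = 0 ∨ d3 = 1) (h4' : d4 = 0 ∨ d4 = 1) (h5' : d5 = 0 ∨ d5 = 1)
    (i34 : g34 ≤ 1 - c3*c4) (i35 : g35 ≤ 1 - c3*c5) (i45 : g45 ≤ 1 - c4*c5)
    (j34 : g34 ≤ 1 - d3*d4) (j35 : g35 ≤ 1 - d3*d5) (j45 : g45 ≤ 1 - d4*d5) :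
    b*(x1*(u*c3+v*c4+w*c5) + x2*(u*d3+v*d4+w*d5) + (u*v*g34+u*w*g35+v*w*g45))
      ≤ b*(x1+x2)*(u+v+w) + (x1+x2)*(u^2+v^2+w^2)/2 := by
  have huv := mul_nonneg hu hv
  have huw := mul_nonneg hu hw
  have hvw := mul_nonneg hv hw
  rcases le_total (u*d3+v*d4+w*d5) (u*c3+v*c4+w*c5) with hle | hle
  · refine le_trans ?_ (poly_core (x1+x2) u v w b c3 c4 c5 hs hu hv hw hb h h3 h4 h5)
    apply mul_le_mul_of_nonneg_left _ hb
    linarith [mul_le_mul_of_nonneg_left hle h2, mul_le_mul_of_nonneg_left i34 huv,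
      mul_le_mul_of_nonneg_left i35 huw, mul_le_mul_of_nonneg_left i45 hvw]
  · refine le_trans ?_ (poly_core (x1+x2) u v w b d3 d4 d5 hs hu hv hw hb h h3' h4' h5')
    apply mul_le_mul_of_nonneg_left _ hb
    linarith [mul_le_mul_of_nonneg_left hle h1, mul_le_mul_of_nonneg_left j34 huv,
      mul_le_mul_of_nonneg_left j35 huw, mul_le_mul_of_nonneg_left j45 hvw]

lemma case_typeIII (E : Finset (Finset ℕ)) (w : ℕ → ℝ) (v1 v2 v3 v4 v5 : ℕ) (B : Finset ℕ)
    (hE : Hit E) (hc : Cfg E v1 v2 v3 v4 v5) (n1 : v1 ∉ B) (n2 : v2 ∉ B) (n3 : v3 ∉ B)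
    (n4 : v4 ∉ B) (n5 : v5 ∉ B) (w1 : 0 ≤ w v1) (w2 : 0 ≤ w v2) (w3 : 0 ≤ w v3)
    (w4 : 0 ≤ w v4) (w5 : 0 ≤ w v5) (wB : ∀ v ∈ B, 0 ≤ w v)
    (hs : w v1 + w v2 + w v3 + w v4 + w v5 + ∑ y ∈ B, w y = 1) (h345 : {v3, v4, v5} ∉ E)
    (hsm : 1/4 ≤ w v1 + w v2)
    (i34 : ∀ y ∈ B, {y, v4, v3} ∈ E → {y, v3, v1} ∈ E → {y, v4, v1} ∈ E → False)
    (i35 : ∀ y ∈ B, {y, v5, v3} ∈ E → {y, v3, v1} ∈ E → {y, v5, v1} ∈ E → False)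
    (i45 : ∀ y ∈ B, {y, v5, v4} ∈ E → {y, v4, v1} ∈ E → {y, v5, v1} ∈ E → False)
    (j34 : ∀ y ∈ B, {y, v4, v3} ∈ E → {y, v3, v2} ∈ E → {y, v4, v2} ∈ E → False)
    (j35 : ∀ y ∈ B, {y, v5, v3} ∈ E → {y, v3, v2} ∈ E → {y, v5, v2} ∈ E → False)
    (j45 : ∀ y ∈ B, {y, v5, v4} ∈ E → {y, v4, v2} ∈ E → {y, v5, v2} ∈ E → False) :
    SS E w 3 ∅ (insert v1 (insert v2 (insert v3 (insert v4 (insert v5 B)))))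
      ≤ Real.sqrt 3 / 18 := by
  have b0 : 0 ≤ ∑ y ∈ B, w y := Finset.sum_nonneg wB
  refine le_trans (bound_general E w v1 v2 v3 v4 v5 B hE hc n1 n2 n3 n4 n5 w1 w2 w3 w4 w5 wB h345) ?_
  obtain ⟨χ, hχ⟩ : ∃ χ : Finset ℕ → ℝ, χ = fun e => if e ∈ E then 1 else 0 := ⟨_, rfl⟩
  have hχ01 : ∀ e, χ e = 0 ∨ χ e = 1 := by
    intro e; rw [hχ]; dsimp only; split_ifs <;> simp
  have hχg : ∀ e f g, (e ∈ E → f ∈ E → g ∈ E → False) → χ e ≤ 1 - χ f * χ g := by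
    intro e f g h; rw [hχ]; dsimp only; split_ifs <;> first | (norm_num; done) | tauto
  have s1 : ∀ A, SS E w 1 A B = ∑ y ∈ B, w y * χ (insert y A) := by
    intro A; rw [SS_one, hχ]
  obtain ⟨T, hT⟩ : ∃ T : ℕ → ℝ, T = fun y =>
    w v1 * (w v3 * χ {y, v3, v1} + w v4 * χ {y, v4, v1} + w v5 * χ {y, v5, v1})
    + w v2 * (w v3 * χ {y, v3, v2} + w v4 * χ {y, v4, v2} + w v5 * χ {y, v5, v2})
    + (w v3 * w v4 * χ {y, v4, v3} + w v3 * w v5 * χ {y, v5, v3} + w v4 * w v5 * χ {y, v5, v4}) :=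
    ⟨_, rfl⟩
  have hsum : ((w v1 * w v3 * SS E w 1 {v3, v1} B + w v1 * w v4 * SS E w 1 {v4, v1} B
        + w v1 * w v5 * SS E w 1 {v5, v1} B)
      + (w v2 * w v3 * SS E w 1 {v3, v2} B + w v2 * w v4 * SS E w 1 {v4, v2} B
        + w v2 * w v5 * SS E w 1 {v5, v2} B)
      + (w v3 * w v4 * SS E w 1 {v4, v3} B + w v3 * w v5 * SS E w 1 {v5, v3} B
        + w v4 * w v5 * SS E w 1 {v5, v4} B)) = ∑ y ∈ B, w y * T y := by
    simp only [s1, Finset.mul_sum, ← Finset.sum_add_distrib]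
    apply Finset.sum_congr rfl
    intro y _
    rw [hT]; ring
  rw [hsum]
  obtain ⟨b, hb⟩ : ∃ b, b = ∑ y ∈ B, w y := ⟨_, rfl⟩
  have hTy : ∀ y ∈ B, b * T y ≤ b*(w v1 + w v2)*(w v3 + w v4 + w v5)
      + (w v1 + w v2)*((w v3)^2+(w v4)^2+(w v5)^2)/2 := by
    intro y hy
    rw [hT]
    exact poly_per_vertex (w v1) (w v2) (w v3) (w v4) (w v5) b _ _ _ _ _ _ _ _ _ w1 w2 hsm w3 w4 w5
      (hb ▸ b0) (hb ▸ hs) (hχ01 _) (hχ01 _) (hχ01 _) (hχ01 _) (hχ01 _) (hχ01 _)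
      (hχg _ _ _ (i34 y hy)) (hχg _ _ _ (i35 y hy)) (hχg _ _ _ (i45 y hy))
      (hχg _ _ _ (j34 y hy)) (hχg _ _ _ (j35 y hy)) (hχg _ _ _ (j45 y hy))
  have key : ∑ y ∈ B, w y * T y ≤ b*(w v1 + w v2)*(w v3 + w v4 + w v5)
      + (w v1 + w v2)*((w v3)^2+(w v4)^2+(w v5)^2)/2 := by
    rcases eq_or_lt_of_le b0 with h0 | h0
    · have hz := (Finset.sum_eq_zero_iff_of_nonneg wB).1 h0.symm
      rw [Finset.sum_eq_zero (fun y hy => by rw [hz y hy, zero_mul])]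
      rw [hb]; positivity
    · rw [← hb] at h0
      apply le_of_mul_le_mul_left _ h0
      have : ∑ y ∈ B, w y * (b * T y) ≤ ∑ y ∈ B, w y * (b*(w v1 + w v2)*(w v3 + w v4 + w v5)
        + (w v1 + w v2)*((w v3)^2+(w v4)^2+(w v5)^2)/2) :=
        Finset.sum_le_sum fun y hy => mul_le_mul_of_nonneg_left (hTy y hy) (wB y hy)
      rw [← Finset.sum_mul, ← hb] at this
      refine le_trans (le_of_eq ?_) this
      rw [Finset.mul_sum]
      exact Finset.sum_congr rfl fun y _ => by ring
  rw [← hb] at hs b0 ⊢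
  refine le_trans ?_ (poly_base (w v1 + w v2) (by positivity) (by linarith))
  have k1 := mul_le_mul_of_nonneg_left (SS_two_le E w B wB {v1}) w1
  have k2 := mul_le_mul_of_nonneg_left (SS_two_le E w B wB {v2}) w2
  rw [← hb] at k1 k2
  have hb' : b = 1 - (w v1 + w v2 + w v3 + w v4 + w v5) := by linarith
  have k3 : w v1 * w v2 * (1 - w v1 - w v2) ≤ (w v1 + w v2)^2/4 * (1 - w v1 - w v2) :=
    mul_le_mul_of_nonneg_right (by nlinarith [sq_nonneg (w v1 - w v2)]) (by linarith)
  have k4 : (w v1 + w v2)^2/4 * (1 - w v1 - w v2) + (w v1 + w v2) * (b^2/2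
      + b * (w v3 + w v4 + w v5) + ((w v3)^2+(w v4)^2+(w v5)^2)/2
      + (w v3 * w v4 + w v3 * w v5 + w v4 * w v5))
      = (w v1 + w v2) * (1 - (w v1 + w v2)) * (2 - (w v1 + w v2)) / 4 := by
    rw [hb']; ring
  have k5 : w v1 * w v2 * b + w v1 * w v2 * (w v3 + w v4 + w v5)
      = w v1 * w v2 * (1 - w v1 - w v2) := by rw [hb']; ring
  linarith

lemma case_all (E : Finset (Finset ℕ)) (w : ℕ → ℝ) (v1 v2 v3 v4 v5 : ℕ) (B : Finset ℕ)
    (hE : Hit E) (hc : Cfg E v1 v2 v3 v4 v5) (n1 : v1 ∉ B) (n2 : v2 ∉ B) (n3 : v3 ∉ B)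
    (n4 : v4 ∉ B) (n5 : v5 ∉ B) (w1 : 0 ≤ w v1) (w2 : 0 ≤ w v2) (w3 : 0 ≤ w v3)
    (w4 : 0 ≤ w v4) (w5 : 0 ≤ w v5) (wB : ∀ v ∈ B, 0 ≤ w v)
    (hs : w v1 + w v2 + w v3 + w v4 + w v5 + ∑ y ∈ B, w y = 1) :
    SS E w 3 ∅ (insert v1 (insert v2 (insert v3 (insert v4 (insert v5 B)))))
      ≤ Real.sqrt 3 / 18 := by
  by_cases h345 : {v3, v4, v5} ∈ E
  · exact (case_K5 E w v1 v2 v3 v4 v5 B hE hc n1 n2 n3 n4 n5 w1 w2 w3 w4 w5 wB hs h345).trans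
      poly_sqrt
  rcases le_total (w v1 + w v2) (1/4) with hsm | hsm
  · exact (case_small E w v1 v2 v3 v4 v5 B hE hc n1 n2 n3 n4 n5 w1 w2 w3 w4 w5 wB hs h345
      hsm).trans poly_sqrt
  by_contra hlt
  have hlt' : ¬ SS E w 3 ∅ (insert v1 (insert v2 (insert v3 (insert v4 (insert v5 B)))))
      ≤ 0.0962 := fun h => hlt (h.trans poly_sqrt)
  have c12 : ∀ a b W, (insert a (insert b W) : Finset ℕ) = insert b (insert a W) :=
    fun a b W => Finset.insert_comm a b W
  have rev : ∀ {a b c : ℕ}, {a, b, c} ∈ E → {c, b, a} ∈ E :=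
    fun h => tri_swap (tri_swap2 (tri_swap h))
  have I : ∀ u1 u2 u3 u4 u5 : ℕ, Cfg E u1 u2 u3 u4 u5 → u1 ∉ B → u2 ∉ B → u3 ∉ B → u4 ∉ B →
      u5 ∉ B → 0 ≤ w u1 → 0 ≤ w u2 → 0 ≤ w u3 → 0 ≤ w u4 → 0 ≤ w u5 →
      w u1 + w u2 + w u3 + w u4 + w u5 + ∑ y ∈ B, w y = 1 → {u3, u4, u5} ∉ E →
      (insert u1 (insert u2 (insert u3 (insert u4 (insert u5 B)))) : Finset ℕ) =
        insert v1 (insert v2 (insert v3 (insert v4 (insert v5 B)))) →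
      ∀ y ∈ B, {u3, u4, y} ∈ E → {u1, u3, y} ∈ E → {u1, u4, y} ∈ E → False := by
    intro u1 u2 u3 u4 u5 hcu m1 m2 m3 m4 m5 p1 p2 p3 p4 p5 hsu hnu heq y hy g1 g2 g3
    apply hlt'
    rw [← heq]
    exact case_typeI E w u1 u2 u3 u4 u5 B hE hcu m1 m2 m3 m4 m5 p1 p2 p3 p4 p5 wB hsu hnu y hy
      g1 g2 g3
  have h354 : {v3, v5, v4} ∉ E := fun h => h345 (tri_swap2 h)
  have h453 : {v4, v5, v3} ∉ E := fun h => h345 (tri_swap (tri_swap2 h))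
  apply hlt
  refine case_typeIII E w v1 v2 v3 v4 v5 B hE hc n1 n2 n3 n4 n5 w1 w2 w3 w4 w5 wB hs h345 hsm
    ?_ ?_ ?_ ?_ ?_ ?_ <;> intro y hy g1 g2 g3
  · exact I v1 v2 v3 v4 v5 hc n1 n2 n3 n4 n5 w1 w2 w3 w4 w5 (by linarith) h345 rfl y hy
      (rev g1) (rev g2) (rev g3)
  · exact I v1 v2 v3 v5 v4 hc.swap45 n1 n2 n3 n5 n4 w1 w2 w3 w5 w4 (by linarith) h354
      (by clear * -; ext; simp only [Finset.mem_insert]; tauto) y hy (rev g1) (rev g2) (rev g3)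
  · exact I v1 v2 v4 v5 v3 hc.swap34.swap45 n1 n2 n4 n5 n3 w1 w2 w4 w5 w3 (by linarith) h453
      (by clear * -; ext; simp only [Finset.mem_insert]; tauto) y hy (rev g1) (rev g2) (rev g3)
  · exact I v2 v1 v3 v4 v5 hc.swap12 n2 n1 n3 n4 n5 w2 w1 w3 w4 w5 (by linarith) h345
      (by clear * -; ext; simp only [Finset.mem_insert]; tauto) y hy (rev g1) (rev g2) (rev g3)
  · exact I v2 v1 v3 v5 v4 hc.swap12.swap45 n2 n1 n3 n5 n4 w2 w1 w3 w5 w4 (by linarith) h354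
      (by clear * -; ext; simp only [Finset.mem_insert]; tauto) y hy (rev g1) (rev g2) (rev g3)
  · exact I v2 v1 v4 v5 v3 hc.swap12.swap34.swap45 n2 n1 n4 n5 n3 w2 w1 w4 w5 w3 (by linarith) h453
      (by clear * -; ext; simp only [Finset.mem_insert]; tauto) y hy (rev g1) (rev g2) (rev g3)

/-- A dense `K_4^3 ∪ e`-free 3-graph with Lagrangian greater than `√3/18` is
`K_5^{3−}`-free. -/
theorem dense_K43e_free_K53minus_free (G : ThreeGraph) (hdense : G.LagDense)
    (hfree : G.Free K43e) (hlag : Real.sqrt 3 / 18 < G.lag) : G.Free K53minus := by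
  rintro ⟨f, hinj, hv, he⟩
  have hE := hit_of_free G hfree
  apply not_le.2 hlag
  apply Real.sSup_le _ (by positivity)
  rintro _ ⟨w, ⟨hw0, hw1⟩, rfl⟩
  have m : ∀ i ∈ ({1, 2, 3, 4, 5} : Finset ℕ), f i ∈ G.verts := hv
  have ne : ∀ i ∈ ({1, 2, 3, 4, 5} : Finset ℕ), ∀ j ∈ ({1, 2, 3, 4, 5} : Finset ℕ), i ≠ j →
      f i ≠ f j := fun i hi j hj hij h => hij (hinj hi hj h)
  have ed : ∀ i j k : ℕ, {i, j, k} ∈ K53minus.edges → {f i, f j, f k} ∈ G.edges := by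
    intro i j k h
    have := he _ h
    simpa [Finset.image_insert] using this
  have hc : Cfg G.edges (f 1) (f 2) (f 3) (f 4) (f 5) := by
    refine ⟨?_, ed _ _ _ (by decide), ed _ _ _ (by decide), ed _ _ _ (by decide),
      ed _ _ _ (by decide), ed _ _ _ (by decide), ed _ _ _ (by decide), ed _ _ _ (by decide),
      ed _ _ _ (by decide), ed _ _ _ (by decide)⟩
    simp [ne]
  have nd := hc.nd
  have hn := ne5 nd
  rw [lagFun_eq_SS]
  obtain ⟨B, hB⟩ : ∃ B, B = G.verts \ {f 1, f 2, f 3, f 4, f 5} := ⟨_, rfl⟩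
  have n1 : f 1 ∉ B := by simp [hB]
  have n2 : f 2 ∉ B := by simp [hB]
  have n3 : f 3 ∉ B := by simp [hB]
  have n4 : f 4 ∉ B := by simp [hB]
  have n5 : f 5 ∉ B := by simp [hB]
  have hV : G.verts = insert (f 1) (insert (f 2) (insert (f 3) (insert (f 4) (insert (f 5) B)))) := by
    rw [hB]
    exact split_verts _ _ _ _ _ _ ⟨m 1 (by simp), m 2 (by simp), m 3 (by simp), m 4 (by simp),
      m 5 (by simp)⟩
  rw [hV] at hw1
  rw [sum_insert5 w B _ _ _ _ _ nd n1 n2 n3 n4 n5] at hw1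
  rw [hV]
  exact case_all G.edges w _ _ _ _ _ B hE hc n1 n2 n3 n4 n5 (hw0 _ (m 1 (by simp)))
    (hw0 _ (m 2 (by simp))) (hw0 _ (m 3 (by simp))) (hw0 _ (m 4 (by simp)))
    (hw0 _ (m 5 (by simp))) (fun v hv => hw0 v (by rw [hV]; simp [hv])) (by linarith)
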